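/- Let a, b ∈ ℤ_p with b not divisible by p. Then the ℤ_p-algebra homomorphism ℤ_p[[S]] → ℤ_p[[S,T]]/((1+S)^a·(1+T)^b − 1) sending S to the residue class of S is a ring isomorphism. -/

import Mathlib

open PowerSeries

/-- The `p`-adic binomial coefficient `C(a,n) = (1/n!) ∏_{i=0}^{n-1} (a - i) ∈ ℚ_p`
for `a ∈ ℤ_p`. -/
noncomputable def padicBinom (p : ℕ) [Fact p.Prime] (a : ℤ_[p]) (n : ℕ) : ℚ_[p] :=
  (n.factorial : ℚ_[p])⁻¹ * ∏ i ∈ Finset.range n, ((a : ℚ_[p]) - i)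

namespace PowerSeries

variable {A : Type*} [CommRing A]

/-- If the constant coefficient of `g` lies in a proper ideal `I` and the linear coefficient of `g`
is a unit, then the image of `g` in `(A ⧸ I)⟦X⟧` has order one. -/
theorem order_map_mk_eq_one {I : Ideal A} (hI : I ≠ ⊤) {g : A⟦X⟧}
    (h0 : coeff 0 g ∈ I) (h1 : IsUnit (coeff 1 g)) :
    (g.map (Ideal.Quotient.mk I)).order = 1 := by
  rw [← Nat.cast_one, order_eq_nat]
  refine ⟨?_, fun i hi ↦ ?_⟩
  · rw [coeff_map, Ne, Ideal.Quotient.eq_zero_iff_mem]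
    exact fun h ↦ hI (Ideal.eq_top_of_isUnit_mem _ h h1)
  · obtain rfl : i = 0 := by lia
    rwa [coeff_map, Ideal.Quotient.eq_zero_iff_mem]

/-- If `A` is `I`-adically complete, the constant coefficient of `g` lies in `I` and the linear
coefficient of `g` is a unit, then `A → A⟦X⟧ ⧸ (g)` is bijective. -/
theorem bijective_mk_comp_C (I : Ideal A) [IsAdicComplete I A] (hI : I ≠ ⊤) {g : A⟦X⟧}
    (h0 : coeff 0 g ∈ I) (h1 : IsUnit (coeff 1 g)) :
    Function.Bijective ((Ideal.Quotient.mk (Ideal.span {g})).comp (C (R := A))) := by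
  have hord : (g.map (Ideal.Quotient.mk I)).order.toNat = 1 := by
    rw [order_map_mk_eq_one hI h0 h1, ENat.toNat_one]
  have H : g.IsWeierstrassDivisorAt I := by
    rwa [IsWeierstrassDivisorAt, hord]
  constructor
  · refine (injective_iff_map_eq_zero _).mpr fun r hr ↦ ?_
    rw [RingHom.comp_apply, Ideal.Quotient.eq_zero_iff_mem, Ideal.mem_span_singleton] at hr
    obtain ⟨q, hq⟩ := hr
    refine Polynomial.C_eq_zero.mp (H.eq_zero_of_mul_eq (q := q) (r := Polynomial.C r) ?_ ?_).2
    · rw [hord]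
      exact Polynomial.degree_C_lt
    · rw [Polynomial.coe_C, hq]
  · intro y
    obtain ⟨f, rfl⟩ := Ideal.Quotient.mk_surjective y
    obtain ⟨hdeg, hf⟩ := H.isWeierstrassDivisionAt_div_mod f
    rw [hord, Nat.cast_one, Nat.WithBot.lt_one_iff_le_zero] at hdeg
    refine ⟨(H.mod f).coeff 0, ?_⟩
    rw [Polynomial.eq_C_of_degree_le_zero hdeg, Polynomial.coe_C] at hf
    rw [RingHom.comp_apply, Ideal.Quotient.eq, Ideal.mem_span_singleton]
    exact ⟨-H.div f, by linear_combination -hf⟩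

end PowerSeries

theorem padicBinom_zero (p : ℕ) [Fact p.Prime] (a : ℤ_[p]) : padicBinom p a 0 = 1 := by
  simp [padicBinom]

theorem padicBinom_one (p : ℕ) [Fact p.Prime] (a : ℤ_[p]) : padicBinom p a 1 = a := by
  simp [padicBinom]

/-- Let `a, b ∈ ℤ_p` with `p ∤ b`.  Realize `ℤ_p[[S,T]]` as the iterated
power series ring `ℤ_p[[S]][[T]]`, and let `ga, gb : ℕ → ℤ_p` be the coefficients of the
binomial series `(1+S)^a = Σ C(a,n) Sⁿ` and `(1+T)^b = Σ C(b,n) Tⁿ`.  Then the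
`ℤ_p`-algebra homomorphism `ℤ_p[[S]] → ℤ_p[[S,T]]/((1+S)^a (1+T)^b - 1)` sending `S` to the
residue class of `S` (i.e. the composite of the constant-in-`T` embedding with the quotient
map) is a ring isomorphism. -/
theorem statement7 (p : ℕ) [Fact p.Prime] (hp : Odd p) (a b : ℤ_[p])
    (hb : ¬ (p : ℤ_[p]) ∣ b)
    (ga gb : ℕ → ℤ_[p])
    (hga : ∀ n, ((ga n : ℚ_[p])) = padicBinom p a n)
    (hgb : ∀ n, ((gb n : ℚ_[p])) = padicBinom p b n) :
    Function.Bijective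
      ⇑((Ideal.Quotient.mk (Ideal.span
          {(PowerSeries.C (R := PowerSeries ℤ_[p]) (PowerSeries.mk ga)) *
            (PowerSeries.mk fun n => PowerSeries.C (R := ℤ_[p]) (gb n)) - 1})).comp
        (PowerSeries.C (R := PowerSeries ℤ_[p]))) := by
  have hga0 : ga 0 = 1 := by
    exact PadicInt.ext <| by simpa using (hga 0).trans (padicBinom_zero p a)
  have hgb0 : gb 0 = 1 := by
    exact PadicInt.ext <| by simpa using (hgb 0).trans (padicBinom_zero p b)
  have hgb1 : gb 1 = b := by
    exact PadicInt.ext <| by simpa using (hgb 1).trans (padicBinom_one p b)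
  have hb_unit : IsUnit b := by
    rwa [← IsLocalRing.notMem_maximalIdeal, PadicInt.maximalIdeal_eq_span_p,
      Ideal.mem_span_singleton]
  refine PowerSeries.bijective_mk_comp_C (Ideal.span {PowerSeries.X}) ?_ ?_ ?_
  · rw [Ne, Ideal.span_singleton_eq_top]
    exact PowerSeries.X_prime.not_isUnit
  · rw [Ideal.mem_span_singleton, PowerSeries.X_dvd_iff]
    simp [hga0, hgb0]
  · rw [PowerSeries.isUnit_iff_constantCoeff]
    simpa [PowerSeries.coeff_one, hga0, hgb1] using hb_unit
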